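/- arXiv:1501.02407 — 2 statements merged into one kernel-verified Lean document; each statement's English description precedes it below -/
import Mathlib

section
/- Let |g|<1, theta, mu in [0,pi], and set u_plus = 1+g^2-2g*cos(theta+mu), u_minus = 1+g^2-2g*cos(theta-mu), assuming u_minus > 0. Then the sum over n >= 0 of ((2n+1)/2) g^n L_n(cos theta) L_n(cos mu) equals (1-g^2)/(pi * u_minus * sqrt(u_plus)) * E0((u_plus - u_minus)/u_plus). -/
open Real

/-- The Legendre polynomials, defined by Bonnet's recursion. -/
noncomputable def legendre : ℕ → ℝ → ℝ
  | 0 => fun _ => 1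
  | 1 => fun x => x
  | (n+2) => fun x =>
      (((2*n+3) : ℝ) * x * legendre (n+1) x - ((n+1) : ℝ) * legendre n x) / ((n+2) : ℝ)

/-- The complete elliptic integral of the second kind, as a function of the modulus `m`. -/
noncomputable def E0 (m : ℝ) : ℝ :=
  ∫ s in (0:ℝ)..(π/2), Real.sqrt (1 - m * Real.sin s ^ 2)

/-! ### Legendre polynomials as elements of `ℝ[X]` -/

namespace HenyeyGreenstein

open Polynomial in
/-- The Legendre polynomials as elements of `ℝ[X]`. -/
noncomputable def legendrePoly : ℕ → ℝ[X]
  | 0 => 1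
  | 1 => X
  | (n+2) => C (((n:ℝ) + 2)⁻¹) *
      (C (2 * (n:ℝ) + 3) * X * legendrePoly (n+1) - C ((n:ℝ) + 1) * legendrePoly n)

theorem legendre_bonnet (n : ℕ) (x : ℝ) :
    ((n:ℝ) + 2) * legendre (n+2) x =
      (2 * (n:ℝ) + 3) * x * legendre (n+1) x - ((n:ℝ) + 1) * legendre n x := by
  have : ((n:ℝ) + 2) ≠ 0 := by positivity
  simp only [legendre]
  field_simp

theorem eval_legendrePoly (x : ℝ) : ∀ n, (legendrePoly n).eval x = legendre n x
  | 0 => by simp [legendrePoly, legendre]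
  | 1 => by simp [legendrePoly, legendre]
  | (n+2) => by
    simp [legendrePoly, legendre, eval_legendrePoly x n, eval_legendrePoly x (n+1)]
    ring

/-- The value of the derivative of the `n`-th Legendre polynomial. -/
noncomputable def legendreDeriv (n : ℕ) (x : ℝ) : ℝ := (legendrePoly n).derivative.eval x

/-- The value of the second derivative of the `n`-th Legendre polynomial. -/
noncomputable def legendreDerivTwo (n : ℕ) (x : ℝ) : ℝ :=
  (legendrePoly n).derivative.derivative.eval x

theorem hasDerivAt_legendre (n : ℕ) (x : ℝ) : HasDerivAt (legendre n) (legendreDeriv n x) x := by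
  have h := (legendrePoly n).hasDerivAt x
  rwa [funext fun y => eval_legendrePoly y n] at h

theorem hasDerivAt_legendreDeriv (n : ℕ) (x : ℝ) :
    HasDerivAt (legendreDeriv n) (legendreDerivTwo n x) x :=
  (legendrePoly n).derivative.hasDerivAt x

theorem continuous_legendre (n : ℕ) : Continuous (legendre n) :=
  continuous_iff_continuousAt.2 fun x => (hasDerivAt_legendre n x).continuousAt

theorem continuous_legendreDeriv (n : ℕ) : Continuous (legendreDeriv n) :=
  (legendrePoly n).derivative.continuous

theorem continuous_legendreDerivTwo (n : ℕ) : Continuous (legendreDerivTwo n) :=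
  (legendrePoly n).derivative.derivative.continuous

theorem legendreDeriv_bonnet (n : ℕ) (x : ℝ) :
    ((n:ℝ) + 2) * legendreDeriv (n+2) x =
      (2 * (n:ℝ) + 3) * (legendre (n+1) x + x * legendreDeriv (n+1) x)
        - ((n:ℝ) + 1) * legendreDeriv n x := by
  have : ((n:ℝ) + 2) ≠ 0 := by positivity
  simp [legendreDeriv, legendrePoly, eval_legendrePoly]
  field_simp

theorem legendreDeriv_succ (n : ℕ) (x : ℝ) :
    legendreDeriv (n+1) x = x * legendreDeriv n x + ((n:ℝ) + 1) * legendre n x ∧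
    x * legendreDeriv (n+1) x - legendreDeriv n x = ((n:ℝ) + 1) * legendre (n+1) x := by
  induction n with
  | zero => simp [legendreDeriv, legendrePoly, legendre]
  | succ n ih =>
    obtain ⟨h1, h2⟩ := ih
    have hn : ((n:ℝ) + 2) ≠ 0 := by positivity
    have hB := legendre_bonnet n x
    have hD := legendreDeriv_bonnet n x
    have key : legendreDeriv (n+2) x
        = x * legendreDeriv (n+1) x + ((n:ℝ) + 2) * legendre (n+1) x := by
      apply mul_left_cancel₀ hn
      linear_combination hD + ((n:ℝ)+1) * h2
    push_cast
    refine ⟨by linear_combination key, ?_⟩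
    linear_combination x * key - hB - h1 + x * h2

theorem legendre_ode (n : ℕ) (x : ℝ) :
    (1 - x^2) * legendreDerivTwo n x - 2 * x * legendreDeriv n x
      + (n:ℝ) * ((n:ℝ) + 1) * legendre n x = 0 := by
  cases n with
  | zero => simp [legendreDerivTwo, legendreDeriv, legendrePoly]
  | succ n =>
    have hfun : (fun y => (1 - y^2) * legendreDeriv (n+1) y)
        = fun y => ((n:ℝ) + 1) * (legendre n y - y * legendre (n+1) y) := by
      funext y
      obtain ⟨h1, h2⟩ := legendreDeriv_succ n y
      linear_combination h1 - y * h2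
    have hl := (((hasDerivAt_id x).pow 2).const_sub 1).mul (hasDerivAt_legendreDeriv (n+1) x)
    have hr := ((hasDerivAt_legendre n x).sub
      ((hasDerivAt_id x).mul (hasDerivAt_legendre (n+1) x))).const_mul ((n:ℝ) + 1)
    have := hl.unique (hr.congr_of_eventuallyEq (.of_forall fun y => congrFun hfun y))
    simp at this
    push_cast
    linear_combination this - ((n:ℝ)+1) * (legendreDeriv_succ n x).2

theorem legendre_neg (x : ℝ) : ∀ n, legendre n (-x) = (-1)^n * legendre n x
  | 0 => by simp [legendre]
  | 1 => by simp [legendre]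
  | (n+2) => by
    simp only [legendre, legendre_neg x n, legendre_neg x (n+1)]
    ring

theorem legendre_one : ∀ n, legendre n 1 = 1
  | 0 => by simp [legendre]
  | 1 => by simp [legendre]
  | (n+2) => by
    have : ((n:ℝ) + 2) ≠ 0 := by positivity
    simp only [legendre, legendre_one n, legendre_one (n+1)]
    field_simp
    ring

/-! ### An energy estimate for Legendre's equation in the angular variable -/

theorem sq_le_sq_zero_of_angular_ode {c : ℝ} (hc : 0 < c) {h h' h'' : ℝ → ℝ}
    (hd : ∀ t, HasDerivAt h (h' t) t) (hd' : ∀ t, HasDerivAt h' (h'' t) t)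
    (ode : ∀ t, sin t * h'' t + cos t * h' t + c * sin t * h t = 0)
    {t : ℝ} (ht : t ∈ Set.Icc 0 (π/2)) : h t ^ 2 ≤ h 0 ^ 2 := by
  have hE : ∀ t, HasDerivAt (fun t => h' t ^ 2 + c * h t ^ 2)
      (2 * h' t * (h'' t + c * h t)) t := fun t => by
    refine (((hd' t).pow 2).add (((hd t).pow 2).const_mul c)).congr_deriv ?_
    norm_num
    ring
  have hanti : AntitoneOn (fun t => h' t ^ 2 + c * h t ^ 2) (Set.Icc 0 (π/2)) := by
    apply antitoneOn_of_deriv_nonpos (convex_Icc _ _)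
    · exact fun t _ => (hE t).continuousAt.continuousWithinAt
    · exact fun t _ => (hE t).differentiableAt.differentiableWithinAt
    · intro t ht
      rw [interior_Icc] at ht
      rw [(hE t).deriv]
      have hs : 0 < sin t := sin_pos_of_pos_of_lt_pi ht.1 (by linarith [ht.2, pi_pos])
      have hcos : 0 ≤ cos t := cos_nonneg_of_mem_Icc ⟨by linarith [ht.1, pi_pos], ht.2.le⟩
      have : sin t * (2 * h' t * (h'' t + c * h t)) ≤ 0 := by
        have e : sin t * (2 * h' t * (h'' t + c * h t)) = -(2 * cos t * h' t ^ 2) := by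
          linear_combination 2 * h' t * ode t
        rw [e]
        have : 0 ≤ 2 * cos t * h' t ^ 2 := by positivity
        linarith
      exact nonpos_of_mul_nonpos_right this hs
  have h0 : h' 0 = 0 := by simpa using ode 0
  have := hanti ⟨le_rfl, by positivity⟩ ht ht.1
  simp only [h0] at this
  have h2 : c * h t ^ 2 ≤ c * h 0 ^ 2 := by nlinarith [sq_nonneg (h' t)]
  exact le_of_mul_le_mul_left h2 hc

theorem sq_le_of_angular_ode {c : ℝ} (hc : 0 < c) {h h' h'' : ℝ → ℝ}
    (hd : ∀ t, HasDerivAt h (h' t) t) (hd' : ∀ t, HasDerivAt h' (h'' t) t)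
    (ode : ∀ t, sin t * h'' t + cos t * h' t + c * sin t * h t = 0)
    {M : ℝ} (h0 : h 0 ^ 2 ≤ M) (hpi : h π ^ 2 ≤ M)
    {t : ℝ} (ht : t ∈ Set.Icc 0 π) : h t ^ 2 ≤ M := by
  rcases le_total t (π/2) with hle | hle
  · exact (sq_le_sq_zero_of_angular_ode hc hd hd' ode ⟨ht.1, hle⟩).trans h0
  · have hr : ∀ t : ℝ, HasDerivAt (fun t : ℝ => π - t) (-1) t :=
      fun t => (hasDerivAt_id t).const_sub π
    have := sq_le_sq_zero_of_angular_ode hc (h := fun t => h (π - t)) (h' := fun t => -h' (π - t))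
      (h'' := fun t => h'' (π - t))
      (fun t => ((hd (π - t)).comp t (hr t)).congr_deriv (by ring))
      (fun t => ((hd' (π - t)).comp t (hr t)).neg.congr_deriv (by ring))
      (fun t => by
        have := ode (π - t)
        rw [sin_pi_sub, cos_pi_sub] at this
        linear_combination this)
      (t := π - t) ⟨by linarith [ht.2], by linarith⟩
    simp only [sub_sub_cancel, sub_zero] at this
    exact this.trans hpi

theorem hasDerivAt_legendre_cos (n : ℕ) (t : ℝ) :
    HasDerivAt (fun t => legendre n (cos t)) (-(sin t * legendreDeriv n (cos t))) t := by
  exact ((hasDerivAt_legendre n (cos t)).comp t (hasDerivAt_cos t)).congr_deriv (by ring)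

theorem hasDerivAt_legendre_cos_two (n : ℕ) (t : ℝ) :
    HasDerivAt (fun t => -(sin t * legendreDeriv n (cos t)))
      (sin t ^ 2 * legendreDerivTwo n (cos t) - cos t * legendreDeriv n (cos t)) t := by
  refine ((hasDerivAt_sin t).mul
    ((hasDerivAt_legendreDeriv n (cos t)).comp t (hasDerivAt_cos t))).neg.congr_deriv ?_
  simp only [Function.comp_apply]
  ring

theorem legendre_cos_ode (n : ℕ) (t : ℝ) :
    sin t * (sin t ^ 2 * legendreDerivTwo n (cos t) - cos t * legendreDeriv n (cos t))
      + cos t * (-(sin t * legendreDeriv n (cos t)))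
      + ((n:ℝ) * ((n:ℝ) + 1)) * sin t * legendre n (cos t) = 0 := by
  linear_combination sin t * legendre_ode n (cos t)
    + sin t * legendreDerivTwo n (cos t) * sin_sq_add_cos_sq t

theorem abs_legendre_le_one (n : ℕ) {x : ℝ} (hx : x ∈ Set.Icc (-1) 1) : |legendre n x| ≤ 1 := by
  rcases Nat.eq_zero_or_pos n with rfl | hn
  · simp [legendre]
  · have hn' : (0:ℝ) < n := by exact_mod_cast hn
    have := sq_le_of_angular_ode (M := 1) (c := (n:ℝ) * ((n:ℝ) + 1)) (by positivity)
      (hasDerivAt_legendre_cos n) (hasDerivAt_legendre_cos_two n) (legendre_cos_ode n)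
      (by simp [legendre_one]) (by simp [legendre_neg, legendre_one, ← pow_mul])
      (t := arccos x) ⟨arccos_nonneg x, arccos_le_pi x⟩
    simp only [cos_arccos hx.1 hx.2] at this
    exact (sq_le_one_iff_abs_le_one _).1 this

/-! ### The product formula for Legendre polynomials -/

theorem hasDerivAt_intervalIntegral_of_continuous {F F' : ℝ → ℝ → ℝ} {a b : ℝ}
    (hF : ∀ x, Continuous (F x)) (hF' : Continuous (Function.uncurry F'))
    (hd : ∀ x t, HasDerivAt (fun y => F y t) (F' x t) x) (x : ℝ) :
    HasDerivAt (fun y => ∫ t in a..b, F y t) (∫ t in a..b, F' x t) x := by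
  obtain ⟨C, hC⟩ := ((isCompact_Icc (a := x - 1) (b := x + 1)).prod
    (isCompact_uIcc (a := a) (b := b))).exists_bound_of_continuousOn hF'.continuousOn
  have hF'x : Continuous (F' x) := hF'.comp (Continuous.prodMk_right x)
  refine (intervalIntegral.hasDerivAt_integral_of_dominated_loc_of_deriv_le (bound := fun _ => C)
    (Icc_mem_nhds (by linarith : x - 1 < x) (by linarith : x < x + 1))
    (.of_forall fun y => (hF y).aestronglyMeasurable) ((hF x).intervalIntegrable a b)
    hF'x.aestronglyMeasurable
    (.of_forall fun t ht y hy => hC (y, t) ⟨hy, Set.uIoc_subset_uIcc ht⟩)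
    intervalIntegrable_const (.of_forall fun t _ y _ => hd y t)).2

theorem integral_legendre_eq_mul (n : ℕ) (θ : ℝ) {μ : ℝ} (hμ : μ ∈ Set.Icc 0 π) :
    ∫ φ in (0:ℝ)..π, legendre n (cos θ * cos μ + sin θ * sin μ * cos φ)
      = π * (legendre n (cos θ) * legendre n (cos μ)) := by
  rcases Nat.eq_zero_or_pos n with rfl | hn
  · simp [legendre]
  have hn' : (0:ℝ) < n := by exact_mod_cast hn
  have cL := continuous_legendre n
  have cL' := continuous_legendreDeriv n
  have cL'' := continuous_legendreDerivTwo n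
  let z : ℝ → ℝ → ℝ := fun t φ => cos θ * cos t + sin θ * sin t * cos φ
  let z' : ℝ → ℝ → ℝ := fun t φ => -(cos θ * sin t) + sin θ * cos t * cos φ
  have cz : Continuous (Function.uncurry z) := by simp only [z, Function.uncurry_def]; fun_prop
  have cz' : Continuous (Function.uncurry z') := by simp only [z', Function.uncurry_def]; fun_prop
  have czt : ∀ t, Continuous (z t) := fun t => by simp only [z]; fun_prop
  have czt' : ∀ t, Continuous (z' t) := fun t => by simp only [z']; fun_prop
  have dz : ∀ t φ, HasDerivAt (fun s => z s φ) (z' t φ) t := fun t φ =>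
    (((hasDerivAt_cos t).const_mul (cos θ)).add
      (((hasDerivAt_sin t).const_mul (sin θ)).mul_const (cos φ))).congr_deriv
        (by simp only [z']; ring)
  have dz' : ∀ t φ, HasDerivAt (fun s => z' s φ) (-z t φ) t := fun t φ =>
    (((hasDerivAt_sin t).const_mul (cos θ)).neg.add
      (((hasDerivAt_cos t).const_mul (sin θ)).mul_const (cos φ))).congr_deriv
        (by simp only [z]; ring)
  have dφ : ∀ t φ, HasDerivAt (z t) (-(sin θ * sin t * sin φ)) φ := fun t φ =>
    (((hasDerivAt_cos φ).const_mul (sin θ * sin t)).const_add (cos θ * cos t)).congr_deriv (by ring)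
  let F' : ℝ → ℝ → ℝ := fun t φ => legendreDeriv n (z t φ) * z' t φ
  let F'' : ℝ → ℝ → ℝ := fun t φ =>
    legendreDerivTwo n (z t φ) * z' t φ ^ 2 - legendreDeriv n (z t φ) * z t φ
  have cF : ∀ t, Continuous fun φ => legendre n (z t φ) := fun t => cL.comp (czt t)
  have cF' : Continuous (Function.uncurry F') := (cL'.comp cz).mul cz'
  have cF'' : Continuous (Function.uncurry F'') :=
    ((cL''.comp cz).mul (cz'.pow 2)).sub ((cL'.comp cz).mul cz)
  have cFt' : ∀ t, Continuous (F' t) := fun t => (cL'.comp (czt t)).mul (czt' t)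
  have cFt'' : ∀ t, Continuous (F'' t) := fun t =>
    ((cL''.comp (czt t)).mul ((czt' t).pow 2)).sub ((cL'.comp (czt t)).mul (czt t))
  have dG := hasDerivAt_intervalIntegral_of_continuous (a := 0) (b := π)
    (F := fun t φ => legendre n (z t φ)) cF cF'
    (fun t φ => (hasDerivAt_legendre n (z t φ)).comp t (dz t φ))
  have dG' := hasDerivAt_intervalIntegral_of_continuous (a := 0) (b := π) (F := F') cFt' cF''
    (fun t φ => by
      have hc : HasDerivAt (fun s => legendreDeriv n (z s φ))
          (legendreDerivTwo n (z t φ) * z' t φ) t :=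
        HasDerivAt.comp (h₂ := legendreDeriv n) t (hasDerivAt_legendreDeriv n (z t φ)) (dz t φ)
      refine (hc.mul (dz' t φ)).congr_deriv ?_
      simp only [F'']
      ring)
  have odeG : ∀ t, sin t * (∫ φ in (0:ℝ)..π, F'' t φ) + cos t * (∫ φ in (0:ℝ)..π, F' t φ)
      + ((n:ℝ) * ((n:ℝ) + 1)) * sin t * (∫ φ in (0:ℝ)..π, legendre n (z t φ)) = 0 := by
    intro t
    have hprim : ∀ φ, HasDerivAt (fun φ => sin θ * (sin φ * legendreDeriv n (z t φ)))
        (sin t * F'' t φ + cos t * F' t φ + ((n:ℝ) * ((n:ℝ) + 1)) * sin t * legendre n (z t φ))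
        φ := by
      intro φ
      refine (((hasDerivAt_sin φ).mul
        ((hasDerivAt_legendreDeriv n (z t φ)).comp φ (dφ t φ))).const_mul (sin θ)).congr_deriv ?_
      have hz2 : z' t φ ^ 2 + z t φ ^ 2 = 1 - sin θ ^ 2 * sin φ ^ 2 := by
        simp only [z, z']
        linear_combination (cos θ ^ 2 + sin θ ^ 2 * cos φ ^ 2) * sin_sq_add_cos_sq t
          + sin_sq_add_cos_sq θ + sin θ ^ 2 * sin_sq_add_cos_sq φ
      have hz1 : sin t * z t φ + cos t * z' t φ = sin θ * cos φ := by
        simp only [z, z']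
        linear_combination (sin θ * cos φ) * sin_sq_add_cos_sq t
      simp only [F', F'', Function.comp_apply]
      linear_combination -sin t * legendre_ode n (z t φ)
        - sin t * legendreDerivTwo n (z t φ) * hz2 - legendreDeriv n (z t φ) * hz1
    have hint := intervalIntegral.integral_eq_sub_of_hasDerivAt (a := 0) (b := π)
      (fun φ _ => hprim φ) (Continuous.intervalIntegrable ((((cFt'' t).const_mul _).add
        ((cFt' t).const_mul _)).add ((cF t).const_mul _)) _ _)
    rw [intervalIntegral.integral_add, intervalIntegral.integral_add,
      intervalIntegral.integral_const_mul, intervalIntegral.integral_const_mul,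
      intervalIntegral.integral_const_mul] at hint
    · simpa using hint
    · exact ((cFt'' t).const_mul _).intervalIntegrable _ _
    · exact ((cFt' t).const_mul _).intervalIntegrable _ _
    · exact (((cFt'' t).const_mul _).add ((cFt' t).const_mul _)).intervalIntegrable _ _
    · exact ((cF t).const_mul _).intervalIntegrable _ _
  set K := π * legendre n (cos θ) with hK
  have hsq := sq_le_of_angular_ode (M := 0) (c := (n:ℝ) * ((n:ℝ) + 1)) (by positivity)
    (fun t => (dG t).sub ((hasDerivAt_legendre_cos n t).const_mul K))
    (fun t => (dG' t).sub ((hasDerivAt_legendre_cos_two n t).const_mul K))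
    (fun t => by
      simp only [Pi.sub_apply]
      linear_combination odeG t - K * legendre_cos_ode n t)
    (by simp [z, hK, legendre_one])
    (by
      simp [z, hK, legendre_one, legendre_neg]
      ring) hμ
  have := pow_eq_zero_iff (two_ne_zero) |>.1 (le_antisymm hsq (sq_nonneg _))
  simp only [Pi.sub_apply, z] at this
  linear_combination this

/-! ### The generating function -/

theorem generating_denominator_pos {g z : ℝ} (hg : |g| < 1) (hz : z ∈ Set.Icc (-1) 1) :
    0 < 1 + g^2 - 2*g*z := by
  obtain ⟨h1, h2⟩ := abs_lt.1 hg
  obtain ⟨h3, h4⟩ := hz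
  nlinarith [mul_nonneg (sub_nonneg.2 h4) (sq_nonneg (1 + g)),
    mul_nonneg (sub_nonneg.2 h3) (sq_nonneg (1 - g)), pow_pos (by linarith : 0 < 1 + g) 2,
    pow_pos (by linarith : 0 < 1 - g) 2]

theorem summable_nat_succ_mul_geometric {r : ℝ} (hr : |r| < 1) :
    Summable fun n : ℕ => ((n:ℝ) + 1) * r ^ n := by
  have h1 := summable_pow_mul_geometric_of_norm_lt_one 1 (r := r) hr
  have h0 := summable_pow_mul_geometric_of_norm_lt_one 0 (r := r) hr
  exact (h1.add h0).congr fun n => by ring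

theorem hasDerivAt_tsum_pow_of_bounded {a : ℕ → ℝ} (ha : ∀ n, |a n| ≤ 1) {g : ℝ} (hg : |g| < 1) :
    HasDerivAt (fun x => ∑' n, a n * x ^ n) (∑' n : ℕ, ((n:ℝ) + 1) * a (n+1) * g ^ n) g := by
  obtain ⟨r, hgr, hr1⟩ := exists_between hg
  have hr0 : 0 < r := (abs_nonneg g).trans_lt hgr
  have hu : Summable fun n : ℕ => (n:ℝ) * r ^ (n-1) := by
    rw [← summable_nat_add_iff 1]
    simpa using summable_nat_succ_mul_geometric (r := r) (by rwa [abs_of_pos hr0])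
  have hbound : ∀ (n : ℕ) (y : ℝ), y ∈ Set.Ioo (-r) r →
      ‖a n * ((n:ℝ) * y ^ (n-1))‖ ≤ (n:ℝ) * r ^ (n-1) := by
    intro n y hy
    have hy' : |y| ≤ r := (abs_lt.2 hy).le
    rw [norm_mul, norm_mul, norm_pow, Real.norm_natCast, Real.norm_eq_abs, Real.norm_eq_abs]
    calc |a n| * ((n:ℝ) * |y| ^ (n-1)) ≤ 1 * ((n:ℝ) * r ^ (n-1)) := by
          gcongr
          exact ha n
      _ = _ := one_mul _
  have hgm : g ∈ Set.Ioo (-r) r := abs_lt.1 hgr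
  have h := hasDerivAt_tsum_of_isPreconnected (g := fun n x => a n * x ^ n)
    (g' := fun n x => a n * ((n:ℝ) * x ^ (n-1))) hu isOpen_Ioo isPreconnected_Ioo
    (fun n y _ => (hasDerivAt_pow n y).const_mul (a n)) hbound
    (y₀ := 0) ⟨by linarith, hr0⟩
    (summable_of_ne_finset_zero (s := {0}) fun n hn => by
      simp only [Finset.mem_singleton] at hn
      simp [hn])
    hgm
  refine h.congr_deriv ?_
  rw [(Summable.of_norm_bounded hu fun n => hbound n g hgm).tsum_eq_zero_add]
  simp only [Nat.cast_zero, zero_mul, mul_zero, zero_add, Nat.cast_add, Nat.cast_one,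
    Nat.add_sub_cancel]
  exact tsum_congr fun n => by ring

theorem tsum_legendre_ode {g z : ℝ} (hg : |g| < 1) (hz : z ∈ Set.Icc (-1) 1) :
    ∃ Q, HasDerivAt (fun x => ∑' n, legendre n z * x ^ n) Q g ∧
      (1 + g^2 - 2*g*z) * Q = (z - g) * ∑' n, legendre n z * g ^ n ∧
      HasSum (fun n : ℕ => (2 * (n:ℝ) + 1) * g ^ n * legendre n z)
        (2 * g * Q + ∑' n, legendre n z * g ^ n) := by
  have ha := fun n => abs_legendre_le_one n hz
  refine ⟨_, hasDerivAt_tsum_pow_of_bounded ha hg, ?_⟩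
  have hg' : |(|g|)| < 1 := by rwa [abs_abs]
  have sP : Summable fun n => legendre n z * g ^ n := by
    refine .of_norm_bounded (summable_geometric_of_abs_lt_one hg') fun n => ?_
    rw [norm_mul, norm_pow, Real.norm_eq_abs, Real.norm_eq_abs]
    exact mul_le_of_le_one_left (by positivity) (ha n)
  have sQ : Summable fun n : ℕ => ((n:ℝ) + 1) * legendre (n+1) z * g ^ n := by
    refine .of_norm_bounded (summable_nat_succ_mul_geometric hg') fun n => ?_
    rw [norm_mul, norm_mul, norm_pow, Real.norm_eq_abs, Real.norm_eq_abs, Real.norm_eq_abs,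
      abs_of_pos (by positivity : (0:ℝ) < n + 1)]
    gcongr
    exact mul_le_of_le_one_right (by positivity) (ha _)
  set P := ∑' n, legendre n z * g ^ n
  set Q := ∑' n : ℕ, ((n:ℝ) + 1) * legendre (n+1) z * g ^ n
  have hP : HasSum (fun n => legendre n z * g ^ n) P := sP.hasSum
  have hQ : HasSum (fun n : ℕ => ((n:ℝ) + 1) * legendre (n+1) z * g ^ n) Q := sQ.hasSum
  have hB : HasSum (fun n : ℕ => (n:ℝ) * legendre n z * g ^ n) (g * Q) := by
    rw [← hasSum_nat_add_iff' 1]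
    simpa using (hQ.mul_left g).congr_fun fun n => by ring
  have hP1 : HasSum (fun n : ℕ => legendre (n+1) z * g ^ (n+1)) (P - 1) := by
    simpa [legendre] using (hasSum_nat_add_iff' 1).2 hP
  have hQ1 : HasSum (fun n : ℕ => ((n:ℝ) + 2) * legendre (n+2) z * g ^ (n+1)) (Q - z) := by
    have := (hasSum_nat_add_iff' 1).2 hQ
    simp only [Finset.sum_range_one, Nat.cast_zero, zero_add, one_mul, pow_zero, mul_one] at this
    rw [show legendre 1 z = z from rfl] at this
    exact this.congr_fun fun n => by push_cast; ring
  have hR : HasSum (fun n : ℕ => ((n:ℝ) + 2) * legendre (n+2) z * g ^ (n+1))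
      (2 * z * g * Q + z * (P - 1) - g * (g * Q + P)) := by
    have := (((hQ.mul_left (2 * z * g)).add (hP1.mul_left z)).sub ((hB.add hP).mul_left g))
    refine this.congr_fun fun n => ?_
    rw [legendre_bonnet]
    ring
  refine ⟨?_, ?_⟩
  · linear_combination hQ1.unique hR
  · rw [mul_assoc]
    exact ((hB.mul_left 2).add hP).congr_fun fun n => by ring

theorem tsum_legendre_mul_sqrt {g z : ℝ} (hg : |g| < 1) (hz : z ∈ Set.Icc (-1) 1) :
    (∑' n, legendre n z * g ^ n) * √(1 + g^2 - 2*g*z) = 1 := by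
  have hW : ∀ x ∈ Set.Ioo (-1 : ℝ) 1,
      HasDerivAt (fun x => (∑' n, legendre n z * x ^ n) * √(1 + x^2 - 2*x*z)) 0 x := by
    intro x hx
    obtain ⟨Q, hQ, hode, -⟩ := tsum_legendre_ode (abs_lt.2 hx) hz
    have hD := generating_denominator_pos (abs_lt.2 hx) hz
    have hdD : HasDerivAt (fun x : ℝ => 1 + x^2 - 2*x*z) (2*x - 2*z) x := by
      refine (((hasDerivAt_pow 2 x).const_add 1).sub
        (((hasDerivAt_id x).const_mul 2).mul_const z)).congr_deriv ?_
      norm_num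
    refine (hQ.mul (hdD.sqrt hD.ne')).congr_deriv ?_
    have hs : √(1 + x^2 - 2*x*z) ≠ 0 := (sqrt_pos.2 hD).ne'
    have hs2 := sq_sqrt hD.le
    generalize √(1 + x^2 - 2*x*z) = w at hs hs2 ⊢
    field_simp
    linear_combination hode + Q * hs2
  have h := isOpen_Ioo.is_const_of_deriv_eq_zero isPreconnected_Ioo
    (fun x hx => (hW x hx).differentiableAt.differentiableWithinAt)
    (fun x hx => (hW x hx).deriv) (abs_lt.1 hg) (show (0:ℝ) ∈ Set.Ioo (-1 : ℝ) 1 by norm_num)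
  rw [h, tsum_eq_single 0 fun n hn => by simp [hn]]
  simp [legendre]

theorem hasSum_legendre_henyey_greenstein {g z : ℝ} (hg : |g| < 1) (hz : z ∈ Set.Icc (-1) 1) :
    HasSum (fun n : ℕ => (2 * (n:ℝ) + 1) * g ^ n * legendre n z)
      ((1 - g^2) / ((1 + g^2 - 2*g*z) * √(1 + g^2 - 2*g*z))) := by
  obtain ⟨Q, -, hode, hS⟩ := tsum_legendre_ode hg hz
  have hD := generating_denominator_pos hg hz
  convert hS using 1
  have hP := tsum_legendre_mul_sqrt hg hz
  rw [div_eq_iff (mul_pos hD (sqrt_pos.2 hD)).ne']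
  linear_combination -(2 * g * √(1 + g^2 - 2*g*z)) * hode - (1 - g^2) * hP

/-! ### The elliptic integral -/

theorem integral_inv_eq_E0_div {m : ℝ} (hm : m < 1) :
    ∫ s in (0:ℝ)..(π/2), ((1 - m * sin s ^ 2) * √(1 - m * sin s ^ 2))⁻¹ = E0 m / (1 - m) := by
  have hD : ∀ s, 0 < 1 - m * sin s ^ 2 := fun s => by
    nlinarith [sin_sq_add_cos_sq s, sq_nonneg (sin s), sq_nonneg (cos s),
      mul_nonneg (sub_nonneg.2 hm.le) (sq_nonneg (sin s))]
  have hsq : ∀ s, 0 < √(1 - m * sin s ^ 2) := fun s => sqrt_pos.2 (hD s)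
  have cD : Continuous fun s => √(1 - m * sin s ^ 2) := by fun_prop
  have cI : Continuous fun s => ((1 - m * sin s ^ 2) * √(1 - m * sin s ^ 2))⁻¹ :=
    Continuous.inv₀ (by fun_prop) fun s => (mul_pos (hD s) (hsq s)).ne'
  have hprim : ∀ s, HasDerivAt (fun s => m * (sin s * cos s) / √(1 - m * sin s ^ 2))
      (√(1 - m * sin s ^ 2) - (1 - m) * ((1 - m * sin s ^ 2) * √(1 - m * sin s ^ 2))⁻¹) s := by
    intro s
    have hdD : HasDerivAt (fun s => 1 - m * sin s ^ 2) (-(2 * m * sin s * cos s)) s := by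
      refine ((((hasDerivAt_sin s).pow 2).const_mul m).const_sub 1).congr_deriv ?_
      norm_num
      ring
    refine ((((hasDerivAt_sin s).mul (hasDerivAt_cos s)).const_mul m).div
      (hdD.sqrt (hD s).ne') (hsq s).ne').congr_deriv ?_
    have hs2 := sq_sqrt (hD s).le
    have h1 := (hsq s).ne'
    generalize √(1 - m * sin s ^ 2) = w at hs2 h1 ⊢
    rw [← hs2]
    simp only [Pi.mul_apply]
    field_simp
    linear_combination (m * (cos s ^ 2 - sin s ^ 2) - w ^ 2 - 1 + m * sin s ^ 2) * hs2
      + m * sin_sq_add_cos_sq s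
  have hint := intervalIntegral.integral_eq_sub_of_hasDerivAt (a := 0) (b := π/2)
    (fun s _ => hprim s) ((cD.sub (cI.const_mul _)).intervalIntegrable _ _)
  rw [intervalIntegral.integral_sub (cD.intervalIntegrable _ _)
    ((cI.const_mul _).intervalIntegrable _ _), intervalIntegral.integral_const_mul] at hint
  simp only [cos_pi_div_two, sin_zero, mul_zero, zero_mul, zero_div, sub_zero] at hint
  rw [eq_div_iff (by linarith), E0]
  linear_combination -hint

end HenyeyGreenstein

open HenyeyGreenstein in
theorem henyey_greenstein_kernel_closed_form (g θ μ : ℝ) (hg : |g| < 1)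
    (hθ : θ ∈ Set.Icc 0 π) (hμ : μ ∈ Set.Icc 0 π)
    (huminus : 0 < 1 + g^2 - 2*g*Real.cos (θ - μ)) :
    ∑' n : ℕ, ((2*(n:ℝ)+1)/2) * g ^ n * legendre n (Real.cos θ) * legendre n (Real.cos μ)
      = (1 - g^2) / (π * (1 + g^2 - 2*g*Real.cos (θ - μ))
            * Real.sqrt (1 + g^2 - 2*g*Real.cos (θ + μ)))
          * E0 (((1 + g^2 - 2*g*Real.cos (θ + μ)) - (1 + g^2 - 2*g*Real.cos (θ - μ)))
              / (1 + g^2 - 2*g*Real.cos (θ + μ))) := by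
  have huplus : 0 < 1 + g^2 - 2*g*cos (θ + μ) :=
    generating_denominator_pos hg (cos_mem_Icc _)
  set z : ℝ → ℝ := fun φ => cos θ * cos μ + sin θ * sin μ * cos φ with hz
  have hz_mem : ∀ φ, z φ ∈ Set.Icc (-1 : ℝ) 1 := by
    intro φ
    have hss : 0 ≤ sin θ * sin μ :=
      mul_nonneg (sin_nonneg_of_mem_Icc hθ) (sin_nonneg_of_mem_Icc hμ)
    have h1 := neg_one_le_cos (θ + μ)
    have h2 := cos_le_one (θ - μ)
    rw [cos_add] at h1
    rw [cos_sub] at h2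
    have h3 := mul_le_mul_of_nonneg_left (cos_le_one φ) hss
    have h4 := mul_le_mul_of_nonneg_left (neg_one_le_cos φ) hss
    constructor <;> simp only [hz] <;> linarith
  have cz : Continuous z := by fun_prop
  have hsum : HasSum
      (fun n : ℕ => ∫ φ in (0:ℝ)..π, (2 * (n:ℝ) + 1) * g ^ n * legendre n (z φ))
      (∫ φ in (0:ℝ)..π, (1 - g^2) / ((1 + g^2 - 2*g*z φ) * √(1 + g^2 - 2*g*z φ))) := by
    have hb : Summable fun n : ℕ => (2 * (n:ℝ) + 1) * |g| ^ n := by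
      have h1 := summable_nat_succ_mul_geometric (r := |g|) (by rwa [abs_abs])
      have h0 := summable_geometric_of_abs_lt_one (r := |g|) (by rwa [abs_abs])
      exact ((h1.mul_left 2).sub h0).congr fun n => by ring
    refine intervalIntegral.hasSum_integral_of_dominated_convergence
      (fun n _ => (2 * (n:ℝ) + 1) * |g| ^ n)
      (fun n => (((continuous_legendre n).comp cz).const_mul _).aestronglyMeasurable)
      (fun n => .of_forall fun φ _ => ?_) (.of_forall fun _ _ => hb)
      intervalIntegrable_const
      (.of_forall fun φ _ => hasSum_legendre_henyey_greenstein hg (hz_mem φ))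
    rw [norm_mul, norm_mul, norm_pow, Real.norm_eq_abs, Real.norm_eq_abs, Real.norm_eq_abs,
      abs_of_pos (by positivity : (0:ℝ) < 2 * n + 1)]
    exact mul_le_of_le_one_right (by positivity) (abs_legendre_le_one n (hz_mem φ))
  simp only [intervalIntegral.integral_const_mul, hz, integral_legendre_eq_mul _ θ hμ] at hsum
  have hsum' := (hsum.mul_left (1 / (2 * π))).congr_fun
    (g := fun n : ℕ => ((2*(n:ℝ)+1)/2) * g ^ n * legendre n (cos θ) * legendre n (cos μ))
    fun n => by
      field_simp
  rw [hsum'.tsum_eq]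
  set p := 1 + g^2 - 2*g*cos (θ + μ) with hp
  set q := 1 + g^2 - 2*g*cos (θ - μ) with hq
  have hm : (p - q) / p < 1 := by
    rw [div_lt_one huplus]
    linarith
  have hsub : ∀ s, 1 + g^2 - 2*g*(cos θ * cos μ + sin θ * sin μ * cos (π - 2 * s))
      = p * (1 - (p - q) / p * sin s ^ 2) := by
    intro s
    have : p * (1 - (p - q) / p * sin s ^ 2) = p - (p - q) * sin s ^ 2 := by
      field_simp
    rw [this, hp, hq, cos_pi_sub, cos_two_mul, cos_add, cos_sub]
    linear_combination (4 * g * sin θ * sin μ) * sin_sq_add_cos_sq s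
  have hchange := intervalIntegral.integral_comp_sub_mul (a := 0) (b := π/2)
    (fun φ => (1 - g^2) / ((1 + g^2 - 2*g*(cos θ * cos μ + sin θ * sin μ * cos φ))
      * √(1 + g^2 - 2*g*(cos θ * cos μ + sin θ * sin μ * cos φ)))) (two_ne_zero (α := ℝ)) π
  simp only [hsub, mul_zero, sub_zero, mul_div_cancel₀ π (two_ne_zero (α := ℝ)), sub_self,
    smul_eq_mul] at hchange
  have hI : (fun s => (1 - g^2) / (p * (1 - (p - q) / p * sin s ^ 2)
        * √(p * (1 - (p - q) / p * sin s ^ 2))))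
      = fun s => ((1 - g^2) / (p * √p)) *
        ((1 - (p - q) / p * sin s ^ 2) * √(1 - (p - q) / p * sin s ^ 2))⁻¹ := by
    funext s
    rw [sqrt_mul huplus.le, ← div_eq_mul_inv, div_div]
    congr 1
    ring
  rw [hI, intervalIntegral.integral_const_mul, integral_inv_eq_E0_div hm] at hchange
  have hm' : 1 - (p - q) / p = q / p := by
    field_simp
    ring
  rw [hm'] at hchange
  rw [← mul_inv_cancel_left₀ (two_ne_zero (α := ℝ)) (∫ φ in (0:ℝ)..π, _), ← hchange]
  have hsp : √p ≠ 0 := (sqrt_pos.2 huplus).ne'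
  field_simp
end

section
/- Let |g|<1 and theta, mu in [0,pi] with theta - mu not a multiple of 2*pi when g is such that u_minus = 0; assume u_minus = 1+g^2-2g*cos(theta-mu) > 0, and set u_plus = 1+g^2-2g*cos(theta+mu). Then the sum over n >= 0 of g^n L_n(cos theta) L_n(cos mu) equals (2/(pi*sqrt(u_plus))) * K0((u_plus - u_minus)/u_plus). -/
open Real

/-- The complete elliptic integral of the first kind, as a function of the modulus `m`. -/
noncomputable def K0 (m : ℝ) : ℝ :=
  ∫ s in (0:ℝ)..(π/2), 1 / Real.sqrt (1 - m * Real.sin s ^ 2)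

namespace Legendre

open Polynomial

/-- The Legendre polynomials as elements of `ℝ[X]`. -/
noncomputable def poly : ℕ → ℝ[X]
  | 0 => 1
  | 1 => X
  | (n + 2) => C ((n + 2 : ℝ)⁻¹) *
      ((2 * (n : ℝ[X]) + 3) * X * poly (n + 1) - ((n : ℝ[X]) + 1) * poly n)

lemma eval_poly (n : ℕ) (x : ℝ) : (poly n).eval x = legendre n x := by
  induction n using Nat.twoStepInduction with
  | zero => simp [poly, legendre]
  | one => simp [poly, legendre]
  | more n ih ih' =>
    simp only [poly, legendre, eval_mul, eval_C, eval_sub, eval_add, eval_natCast, eval_ofNat,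
      eval_X, eval_one, ih, ih']
    ring

lemma poly_bonnet (n : ℕ) : ((n : ℝ[X]) + 2) * poly (n + 2) =
    (2 * (n : ℝ[X]) + 3) * X * poly (n + 1) - ((n : ℝ[X]) + 1) * poly n := by
  have h : ((n : ℝ[X]) + 2) * C ((n + 2 : ℝ)⁻¹) = 1 := by
    have : ((n : ℝ[X]) + 2) = C (n + 2 : ℝ) := by simp [map_ofNat C 2]
    rw [this, ← C_mul, mul_inv_cancel₀ (by positivity), C_1]
  rw [poly, ← mul_assoc, h, one_mul]

lemma derivative_poly_aux (n : ℕ) :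
    X * derivative (poly (n + 1)) - derivative (poly n) = ((n : ℝ[X]) + 1) * poly (n + 1) ∧
    derivative (poly (n + 1)) - X * derivative (poly n) = ((n : ℝ[X]) + 1) * poly n := by
  induction n with
  | zero => simp [poly]
  | succ n ih =>
    obtain ⟨ha, hb⟩ := ih
    have hB := poly_bonnet n
    have hD := congrArg derivative hB
    simp only [derivative_mul, derivative_add, derivative_sub, derivative_natCast,
      derivative_ofNat, derivative_one, derivative_X] at hD
    have hn : ((n : ℝ[X]) + 2) ≠ 0 := by
      have : ((n : ℝ[X]) + 2) = ((n + 2 : ℕ) : ℝ[X]) := by push_cast; ring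
      rw [this]; exact_mod_cast (by lia)
    have hb' : derivative (poly (n + 2)) - X * derivative (poly (n + 1))
        = ((n : ℝ[X]) + 2) * poly (n + 1) := by
      apply mul_left_cancel₀ hn
      linear_combination hD + ((n : ℝ[X]) + 1) * ha
    push_cast
    constructor
    · linear_combination X * hb' - hB + X * ha - hb
    · linear_combination hb'

/-- Legendre's differential operator, shifted by the would-be eigenvalue `N`. -/
noncomputable def op (N : ℝ) (p : ℝ[X]) : ℝ[X] :=
  derivative ((1 - X ^ 2) * derivative p) + C N * p

lemma op_poly (n : ℕ) : op (n * (n + 1)) (poly n) = 0 := by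
  cases n with
  | zero => simp [op, poly]
  | succ n =>
    obtain ⟨ha, hb⟩ := derivative_poly_aux n
    have h : (1 - X ^ 2) * derivative (poly (n + 1)) =
        ((n : ℝ[X]) + 1) * (poly n - X * poly (n + 1)) := by
      linear_combination hb - X * ha
    rw [op, h]
    simp only [derivative_mul, derivative_add, derivative_sub, derivative_natCast,
      derivative_one, derivative_X]
    push_cast
    simp only [map_mul, map_add, map_natCast, map_one]
    linear_combination (-(n : ℝ[X]) - 1) * ha

lemma derivative_one_sub_X_sq : derivative (1 - X ^ 2 : ℝ[X]) = -2 * X := by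
  rw [derivative_sub, derivative_one, pow_two, derivative_mul, derivative_X]
  ring

lemma iterate_derivative_of_op_eq_zero {N : ℝ} {p : ℝ[X]} (h : op N p = 0) (k : ℕ) :
    (1 - X ^ 2) * derivative^[k + 2] p - 2 * ((k : ℝ[X]) + 1) * X * derivative^[k + 1] p
      + (C N - (k : ℝ[X]) * ((k : ℝ[X]) + 1)) * derivative^[k] p = 0 := by
  induction k with
  | zero =>
    rw [op, derivative_mul, derivative_one_sub_X_sq] at h
    simp only [Function.iterate_succ, Function.iterate_zero, Function.comp_apply, id,
      Nat.cast_zero]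
    linear_combination h
  | succ k ih =>
    have hD := congrArg derivative ih
    simp only [derivative_mul, derivative_add, derivative_sub (f := _ * _),
      derivative_sub (f := C _), derivative_natCast, derivative_C, derivative_one_sub_X_sq,
      derivative_ofNat, derivative_one, derivative_X, derivative_zero,
      ← Function.iterate_succ_apply' derivative] at hD
    push_cast
    linear_combination hD

lemma factorial_mul_eval_hasseDeriv (p : ℝ[X]) (k : ℕ) (z : ℝ) :
    (k.factorial : ℝ) * (hasseDeriv k p).eval z = (derivative^[k] p).eval z := by
  rw [← factorial_smul_hasseDeriv, LinearMap.smul_apply, eval_smul, nsmul_eq_mul]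

lemma eq_zero_of_op_eq_zero {N : ℝ} {p : ℝ[X]} (h : op N p = 0) (h1 : p.eval 1 = 0) :
    p = 0 := by
  have key : ∀ k, (derivative^[k] p).eval 1 = 0 := by
    intro k
    induction k with
    | zero => simpa
    | succ k ih =>
      have := congrArg (eval 1) (iterate_derivative_of_op_eq_zero h k)
      simp only [eval_add, eval_sub, eval_mul, eval_pow, eval_X, eval_one, eval_natCast, eval_C,
        eval_ofNat, eval_zero, ih] at this
      have hk : (k : ℝ) + 1 ≠ 0 := by positivity
      have h2 : (2 * ((k : ℝ) + 1)) * (derivative^[k + 1] p).eval 1 = 0 := by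
        linear_combination -this
      simpa [hk] using h2
  apply taylor_injective (1 : ℝ)
  ext k
  rw [taylor_coeff, map_zero, coeff_zero]
  have := factorial_mul_eval_hasseDeriv p k 1
  rw [key] at this
  simpa [Nat.factorial_ne_zero] using this

lemma eval_add_eq_sum (p : ℝ[X]) (m : ℕ) (hm : p.natDegree < m) (z h : ℝ) :
    p.eval (z + h) =
      ∑ k ∈ Finset.range m, (derivative^[k] p).eval z * h ^ k / (k.factorial : ℝ) := by
  have h1 : p.eval (z + h) = (taylor z p).eval h := by rw [taylor_eval, add_comm]
  rw [h1, eval_eq_sum_range' (n := m) (by rwa [natDegree_taylor])]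
  refine Finset.sum_congr rfl fun k _ => ?_
  rw [taylor_coeff, ← factorial_mul_eval_hasseDeriv]
  field_simp

lemma eval_one_poly (n : ℕ) : (poly n).eval 1 = 1 := by
  induction n using Nat.twoStepInduction with
  | zero => simp [poly]
  | one => simp [poly]
  | more n ih ih' =>
    have := congrArg (eval 1) (poly_bonnet n)
    simp [ih, ih'] at this
    have hn : (n : ℝ) + 2 ≠ 0 := by positivity
    apply mul_left_cancel₀ hn
    linear_combination this

lemma eval_neg_one_poly (n : ℕ) : (poly n).eval (-1) = (-1) ^ n := by
  induction n using Nat.twoStepInduction with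
  | zero => simp [poly]
  | one => simp [poly]
  | more n ih ih' =>
    have := congrArg (eval (-1)) (poly_bonnet n)
    simp [ih, ih'] at this
    have hn : (n : ℝ) + 2 ≠ 0 := by positivity
    apply mul_left_cancel₀ hn
    linear_combination this

lemma abs_eval_poly_le_one (n : ℕ) {x : ℝ} (hx : x ∈ Set.Icc (-1) 1) :
    |(poly n).eval x| ≤ 1 := by
  rcases Nat.eq_zero_or_pos n with rfl | hn
  · simp [poly]
  set N : ℝ := n * (n + 1) with hN
  have hNpos : 0 < N := by positivity
  set E : ℝ[X] := C N * poly n ^ 2 + (1 - X ^ 2) * derivative (poly n) ^ 2 with hE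
  have hder : derivative E = 2 * X * derivative (poly n) ^ 2 := by
    have h := op_poly n
    rw [op, derivative_mul, derivative_one_sub_X_sq, ← hN] at h
    rw [hE, derivative_add, derivative_mul, derivative_mul, derivative_one_sub_X_sq, pow_two,
      derivative_mul, pow_two (derivative (poly n)), derivative_mul, derivative_C]
    linear_combination 2 * derivative (poly n) * h
  have hbound : E.eval x ≤ N := by
    rcases le_total 0 x with h0 | h0
    · have hmono : MonotoneOn (fun x => E.eval x) (Set.Icc 0 1) := by
        refine monotoneOn_of_deriv_nonneg (convex_Icc 0 1) E.continuousOn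
          E.differentiable.differentiableOn fun y hy => ?_
        rw [interior_Icc] at hy
        rw [Polynomial.deriv, hder]
        simp only [eval_mul, eval_pow, eval_X, eval_ofNat]
        have := hy.1
        positivity
      have := hmono ⟨h0, hx.2⟩ ⟨zero_le_one, le_rfl⟩ hx.2
      simpa [hE, eval_one_poly] using this
    · have hanti : AntitoneOn (fun x => E.eval x) (Set.Icc (-1) 0) := by
        refine antitoneOn_of_deriv_nonpos (convex_Icc (-1) 0) E.continuousOn
          E.differentiable.differentiableOn fun y hy => ?_
        rw [interior_Icc] at hy
        rw [Polynomial.deriv, hder]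
        simp only [eval_mul, eval_pow, eval_X, eval_ofNat]
        have := hy.2
        exact mul_nonpos_of_nonpos_of_nonneg (by linarith) (sq_nonneg _)
      have := hanti ⟨le_rfl, by norm_num⟩ ⟨hx.1, h0⟩ hx.1
      simpa [hE, eval_neg_one_poly, ← pow_mul, mul_comm] using this
  have h2 : N * (poly n).eval x ^ 2 ≤ N * 1 := by
    have hEx : E.eval x = N * (poly n).eval x ^ 2
        + (1 - x ^ 2) * (derivative (poly n)).eval x ^ 2 := by simp [hE]
    have : 0 ≤ (1 - x ^ 2) * (derivative (poly n)).eval x ^ 2 :=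
      mul_nonneg (by nlinarith [hx.1, hx.2]) (sq_nonneg _)
    linarith
  have h3 := le_of_mul_le_mul_left h2 hNpos
  exact (sq_le_one_iff_abs_le_one _).1 h3

/-- The normalised even moments `(1/π) ∫₀^π cos^{2j} / (2j)!` of the cosine. -/
noncomputable def cosMoment (j : ℕ) : ℝ :=
  (∫ φ in (0 : ℝ)..π, cos φ ^ (2 * j)) / (π * (2 * j).factorial)

lemma cosMoment_zero : cosMoment 0 = 1 := by
  simp [cosMoment, pi_ne_zero]

lemma cosMoment_succ (j : ℕ) :
    4 * ((j : ℝ) + 1) ^ 2 * cosMoment (j + 1) = cosMoment j := by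
  have h : ∫ φ in (0 : ℝ)..π, cos φ ^ (2 * j + 2) =
      (2 * j + 1) / (2 * j + 2) * ∫ φ in (0 : ℝ)..π, cos φ ^ (2 * j) := by
    rw [integral_cos_pow]; simp
  have hf : ((2 * j + 2).factorial : ℝ) = (2 * j + 2) * ((2 * j + 1) * (2 * j).factorial) := by
    rw [Nat.factorial_succ, Nat.factorial_succ]; push_cast; ring
  rw [cosMoment, cosMoment, mul_add, mul_one, h, hf]
  have := pi_ne_zero
  have : ((2 * j).factorial : ℝ) ≠ 0 := by positivity
  field_simp
  ring

lemma integral_cos_pow_odd (j : ℕ) : ∫ φ in (0 : ℝ)..π, cos φ ^ (2 * j + 1) = 0 := by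
  induction j with
  | zero => simp
  | succ j ih =>
    rw [show 2 * (j + 1) + 1 = (2 * j + 1) + 2 by ring, integral_cos_pow, ih]
    simp

/-- The summands of the expansion in `x` of the mean over `φ` of
`p (x y + √(1 - x²) √(1 - y²) cos φ)`. -/
noncomputable def meanTerm (p : ℝ[X]) (y : ℝ) (j : ℕ) : ℝ[X] :=
  C (cosMoment j * (1 - y ^ 2) ^ j) * ((derivative^[2 * j] p).comp (C y * X) * (1 - X ^ 2) ^ j)

lemma op_add (N : ℝ) (p q : ℝ[X]) : op N (p + q) = op N p + op N q := by
  simp only [op, derivative_add, mul_add]; ring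

lemma op_C_mul (N a : ℝ) (p : ℝ[X]) : op N (C a * p) = C a * op N p := by
  have h : (1 - X ^ 2) * derivative (C a * p) = C a * ((1 - X ^ 2) * derivative p) := by
    rw [derivative_C_mul]; ring
  rw [op, h, derivative_C_mul, op]; ring

lemma derivative_iterate_comp (p : ℝ[X]) (y : ℝ) (k : ℕ) :
    derivative ((derivative^[k] p).comp (C y * X)) =
      C y * (derivative^[k + 1] p).comp (C y * X) := by
  rw [derivative_comp, derivative_C_mul, derivative_X, mul_one, Function.iterate_succ_apply']

lemma one_sub_X_sq_mul_derivative_pow (j : ℕ) :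
    (1 - X ^ 2 : ℝ[X]) * derivative ((1 - X ^ 2) ^ j) = -2 * (j : ℝ[X]) * X * (1 - X ^ 2) ^ j := by
  cases j with
  | zero => simp
  | succ j =>
    rw [derivative_pow_succ, derivative_one_sub_X_sq]
    simp only [map_add, map_natCast, map_one]
    push_cast
    ring

lemma iterate_derivative_comp_of_op_eq_zero {N : ℝ} {p : ℝ[X]} (h : op N p = 0) (y : ℝ) (k : ℕ) :
    (1 - (C y * X) ^ 2) * (derivative^[k + 2] p).comp (C y * X)
      - 2 * ((k : ℝ[X]) + 1) * (C y * X) * (derivative^[k + 1] p).comp (C y * X)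
      + (C N - (k : ℝ[X]) * ((k : ℝ[X]) + 1)) * (derivative^[k] p).comp (C y * X) = 0 := by
  have := congrArg (fun q => q.comp (C y * X)) (iterate_derivative_of_op_eq_zero h k)
  simpa only [add_comp, sub_comp, mul_comp, pow_comp, X_comp, one_comp, natCast_comp, C_comp,
    ofNat_comp, Nat.cast_ofNat, zero_comp] using this

lemma op_sum_meanTerm {N : ℝ} {p : ℝ[X]} (h : op N p = 0) (y : ℝ) (J : ℕ) :
    op N (∑ j ∈ Finset.range (J + 1), meanTerm p y j) =
      -(C (cosMoment J * (1 - y ^ 2) ^ (J + 1)) *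
        ((derivative^[2 * J + 2] p).comp (C y * X) * (1 - X ^ 2) ^ J)) := by
  have key : ∀ j : ℕ, (1 - X ^ 2) * derivative
      ((derivative^[2 * j] p).comp (C y * X) * (1 - X ^ 2) ^ j) =
      C y * (derivative^[2 * j + 1] p).comp (C y * X) * (1 - X ^ 2) ^ (j + 1)
        - 2 * (j : ℝ[X]) * X * (derivative^[2 * j] p).comp (C y * X) * (1 - X ^ 2) ^ j := by
    intro j
    rw [derivative_mul, derivative_iterate_comp]
    linear_combination (derivative^[2 * j] p).comp (C y * X) * one_sub_X_sq_mul_derivative_pow j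
  induction J with
  | zero =>
    have h0 := iterate_derivative_comp_of_op_eq_zero h y 0
    rw [Finset.sum_range_one, meanTerm, op_C_mul, op, key]
    simp only [cosMoment_zero, C_1, C_sub, C_pow, pow_zero, mul_one, one_mul,
      zero_add, pow_one, mul_zero, Nat.cast_zero, derivative_mul, derivative_C,
      derivative_iterate_comp, derivative_one_sub_X_sq, zero_mul, sub_zero] at h0 ⊢
    linear_combination h0
  | succ J ih =>
    rw [Finset.sum_range_succ, op_add, ih, meanTerm, op_C_mul, op, key]
    have h0 := iterate_derivative_comp_of_op_eq_zero h y (2 * (J + 1))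
    have hc : C (cosMoment J) = 4 * ((J : ℝ[X]) + 1) ^ 2 * C (cosMoment (J + 1)) := by
      rw [← cosMoment_succ]; simp [map_ofNat C 4]
    simp only [mul_add, mul_one] at h0 ⊢
    have hJ : derivative ((1 - X ^ 2 : ℝ[X]) ^ (J + 1)) =
        ((J : ℝ[X]) + 1) * (1 - X ^ 2) ^ J * (-2 * X) := by
      rw [derivative_pow_succ, derivative_one_sub_X_sq]; simp
    have hJ' : derivative ((1 - X ^ 2 : ℝ[X]) ^ (J + 1 + 1)) =
        ((J : ℝ[X]) + 2) * (1 - X ^ 2) ^ (J + 1) * (-2 * X) := by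
      rw [derivative_pow_succ, derivative_one_sub_X_sq]
      simp only [map_add, map_natCast, map_one]
      push_cast
      ring
    simp only [derivative_mul, derivative_sub (f := _ * _), derivative_C, derivative_iterate_comp,
      derivative_natCast, derivative_ofNat, derivative_X, hJ, hJ', map_mul, map_pow, map_sub,
      map_one, hc]
    push_cast at h0 ⊢
    linear_combination C (cosMoment (J + 1)) * (1 - C y ^ 2) ^ (J + 1) * (1 - X ^ 2) ^ (J + 1) * h0

lemma sum_meanTerm_poly (n J : ℕ) (hJ : (poly n).natDegree ≤ 2 * J) (y : ℝ) :
    ∑ j ∈ Finset.range (J + 1), meanTerm (poly n) y j = C ((poly n).eval y) * poly n := by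
  rw [← sub_eq_zero, sub_eq_add_neg, ← neg_mul, ← C_neg]
  apply eq_zero_of_op_eq_zero (N := n * (n + 1))
  · rw [op_add, op_C_mul, op_poly, op_sum_meanTerm (op_poly n),
      iterate_derivative_eq_zero (by lia)]
    simp
  · rw [eval_add, eval_mul, eval_one_poly, Finset.sum_range_succ', eval_add, eval_finsetSum,
      Finset.sum_eq_zero fun j _ => ?_]
    · simp [meanTerm, cosMoment_zero]
    · simp [meanTerm]

lemma sum_range_two_mul (f : ℕ → ℝ) (J : ℕ) :
    ∑ k ∈ Finset.range (2 * J), f k = ∑ j ∈ Finset.range J, (f (2 * j) + f (2 * j + 1)) := by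
  induction J with
  | zero => simp
  | succ J ih =>
    rw [mul_add, mul_one, Finset.sum_range_succ, Finset.sum_range_succ, ih,
      Finset.sum_range_succ, add_assoc]

/-- The product formula for Legendre polynomials. -/
lemma integral_legendre (n : ℕ) (θ μ : ℝ) :
    ∫ φ in (0 : ℝ)..π, legendre n (cos θ * cos μ + sin θ * sin μ * cos φ) =
      π * (legendre n (cos θ) * legendre n (cos μ)) := by
  simp only [← eval_poly]
  obtain ⟨J, hJ⟩ : ∃ J, (poly n).natDegree ≤ 2 * J := ⟨(poly n).natDegree, by lia⟩
  have hx := congrArg (eval (cos θ)) (sum_meanTerm_poly n J hJ (cos μ))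
  rw [eval_finsetSum, eval_mul, eval_C] at hx
  rw [mul_comm ((poly n).eval (cos θ)), ← hx]
  simp only [eval_add_eq_sum (poly n) (2 * (J + 1)) (by lia)]
  rw [intervalIntegral.integral_finsetSum
    fun k _ => (by fun_prop : Continuous _).intervalIntegrable _ _]
  have hterm : ∀ k : ℕ, ∫ φ in (0 : ℝ)..π, (derivative^[k] (poly n)).eval (cos θ * cos μ) *
        (sin θ * sin μ * cos φ) ^ k / (k.factorial : ℝ) =
      (derivative^[k] (poly n)).eval (cos θ * cos μ) * (sin θ * sin μ) ^ k /
        (k.factorial : ℝ) * ∫ φ in (0 : ℝ)..π, cos φ ^ k := by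
    intro k
    rw [← intervalIntegral.integral_const_mul]
    congr 1
    ext φ
    rw [mul_pow]
    ring
  simp only [hterm]
  rw [sum_range_two_mul, Finset.mul_sum]
  refine Finset.sum_congr rfl fun j _ => ?_
  rw [integral_cos_pow_odd, mul_zero, add_zero, meanTerm, cosMoment, ← sin_sq μ]
  simp only [eval_mul, eval_C, eval_comp, eval_X, eval_pow, eval_sub, eval_one]
  rw [← sin_sq θ, mul_comm (cos μ) (cos θ), pow_mul (sin θ * sin μ), mul_pow, mul_pow]
  have := pi_ne_zero
  field_simp

lemma abs_legendre_le_one (n : ℕ) {x : ℝ} (hx : x ∈ Set.Icc (-1) 1) : |legendre n x| ≤ 1 := by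
  rw [← eval_poly]
  exact abs_eval_poly_le_one n hx

lemma one_sub_two_mul_add_sq_pos {g x : ℝ} (hg : |g| < 1) (hx : x ∈ Set.Icc (-1) 1) :
    0 < 1 + g ^ 2 - 2 * g * x := by
  have h1 : g * x ≤ |g| := by
    calc g * x ≤ |g * x| := le_abs_self _
      _ = |g| * |x| := abs_mul _ _
      _ ≤ |g| * 1 := by gcongr; exact abs_le.2 hx
      _ = |g| := mul_one _
  nlinarith [sq_abs g, sq_nonneg (1 - |g|), mul_pos (sub_pos.2 hg) (sub_pos.2 hg)]

lemma summable_pow_mul_legendre {g x : ℝ} (hg : |g| < 1) (hx : x ∈ Set.Icc (-1) 1) :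
    Summable fun n : ℕ => g ^ n * legendre n x := by
  refine Summable.of_norm_bounded (summable_geometric_of_lt_one (abs_nonneg g) hg) fun n => ?_
  rw [norm_mul, norm_pow, Real.norm_eq_abs, Real.norm_eq_abs]
  exact mul_le_of_le_one_right (by positivity) (abs_legendre_le_one n hx)

lemma summable_nat_mul_pow_pred {r : ℝ} (h0 : 0 < r) (h1 : r < 1) :
    Summable fun n : ℕ => (n : ℝ) * r ^ (n - 1) := by
  have h := (summable_pow_mul_geometric_of_norm_lt_one 1
    (by rwa [Real.norm_eq_abs, abs_of_pos h0] : ‖r‖ < 1)).mul_left r⁻¹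
  refine h.congr fun n => ?_
  cases n with
  | zero => simp
  | succ n => rw [Nat.add_sub_cancel, pow_one, pow_succ]; field_simp

lemma norm_derivative_term_le {g r x : ℝ} (hg : |g| ≤ r) (hx : x ∈ Set.Icc (-1) 1) (n : ℕ) :
    ‖(n : ℝ) * g ^ (n - 1) * legendre n x‖ ≤ (n : ℝ) * r ^ (n - 1) := by
  rw [norm_mul, norm_mul, norm_pow, Real.norm_natCast, Real.norm_eq_abs, Real.norm_eq_abs]
  calc (n : ℝ) * |g| ^ (n - 1) * |legendre n x| ≤ (n : ℝ) * |g| ^ (n - 1) :=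
        mul_le_of_le_one_right (by positivity) (abs_legendre_le_one n hx)
    _ ≤ (n : ℝ) * r ^ (n - 1) := by gcongr

lemma summable_derivative_terms {g x : ℝ} (hg : |g| < 1) (hx : x ∈ Set.Icc (-1) 1) :
    Summable fun n : ℕ => (n : ℝ) * g ^ (n - 1) * legendre n x := by
  obtain ⟨r, hgr, hr1⟩ := exists_between hg
  exact Summable.of_norm_bounded
    (summable_nat_mul_pow_pred ((abs_nonneg g).trans_lt hgr) hr1)
    fun n => norm_derivative_term_le hgr.le hx n

lemma hasDerivAt_tsum_legendre {g x : ℝ} (hg : |g| < 1) (hx : x ∈ Set.Icc (-1) 1) :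
    HasDerivAt (fun g => ∑' n : ℕ, g ^ n * legendre n x)
      (∑' n : ℕ, (n : ℝ) * g ^ (n - 1) * legendre n x) g := by
  obtain ⟨r, hgr, hr1⟩ := exists_between hg
  have hr0 : 0 < r := (abs_nonneg g).trans_lt hgr
  have hmem : ∀ y ∈ Set.Ioo (-r) r, |y| ≤ r := fun y hy => (abs_lt.2 hy).le
  exact hasDerivAt_tsum_of_isPreconnected (t := Set.Ioo (-r) r)
    (summable_nat_mul_pow_pred hr0 hr1) isOpen_Ioo isPreconnected_Ioo
    (fun n y _ => (hasDerivAt_pow n y).mul_const _)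
    (fun n y hy => norm_derivative_term_le (hmem y hy) hx n) (abs_lt.1 hgr)
    (summable_pow_mul_legendre hg hx) (abs_lt.1 hgr)

lemma legendre_bonnet (n : ℕ) (x : ℝ) : ((n : ℝ) + 2) * legendre (n + 2) x =
    (2 * n + 3) * x * legendre (n + 1) x - (n + 1) * legendre n x := by
  rw [legendre]
  field_simp

/-- The differential equation in `g` of the generating function. -/
lemma generating_function_ode {g x : ℝ} (hg : |g| < 1) (hx : x ∈ Set.Icc (-1) 1) :
    (1 + g ^ 2 - 2 * g * x) * (∑' n : ℕ, (n : ℝ) * g ^ (n - 1) * legendre n x) =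
      (x - g) * ∑' n : ℕ, g ^ n * legendre n x := by
  have hS := (summable_pow_mul_legendre hg hx).hasSum
  have hD := (summable_derivative_terms hg hx).hasSum
  set S := ∑' n : ℕ, g ^ n * legendre n x
  set D := ∑' n : ℕ, (n : ℝ) * g ^ (n - 1) * legendre n x
  have hgD : HasSum (fun n : ℕ => (n : ℝ) * g ^ n * legendre n x) (g * D) := by
    refine (hD.mul_left g).congr_fun fun n => ?_
    cases n with
    | zero => simp
    | succ n => rw [Nat.add_sub_cancel, pow_succ]; ring
  have hD1 : HasSum (fun n : ℕ => ((n : ℝ) + 1) * g ^ n * legendre (n + 1) x) D := by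
    simpa using (hasSum_nat_add_iff' 1).2 hD
  have hb : HasSum (fun n : ℕ => g ^ n *
      (((n : ℝ) + 1) * legendre (n + 1) x - (2 * n + 1) * x * legendre n x))
      (D - 2 * x * (g * D) - x * S) := by
    refine ((hD1.sub (hgD.mul_left (2 * x))).sub (hS.mul_left x)).congr_fun fun n => ?_
    ring
  have hb1 := (hasSum_nat_add_iff' 1).2 hb
  have hb2 : HasSum (fun n : ℕ => -(g * ((n : ℝ) * g ^ n * legendre n x)
      + g * (g ^ n * legendre n x))) (-(g * (g * D) + g * S)) :=
    ((hgD.mul_left g).add (hS.mul_left g)).neg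
  have heq := hb1.unique (hb2.congr_fun fun n => by
    push_cast
    linear_combination g ^ (n + 1) * legendre_bonnet n x)
  simp [legendre] at heq
  linear_combination heq

lemma hasSum_legendre {g x : ℝ} (hg : |g| < 1) (hx : x ∈ Set.Icc (-1) 1) :
    HasSum (fun n : ℕ => g ^ n * legendre n x) (1 / √(1 + g ^ 2 - 2 * g * x)) := by
  set S : ℝ → ℝ := fun g => ∑' n : ℕ, g ^ n * legendre n x with hSdef
  have hder : ∀ y ∈ Set.Ioo (-1 : ℝ) 1,
      HasDerivAt (fun y => S y * √(1 + y ^ 2 - 2 * y * x)) 0 y := by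
    intro y hy
    have hy' := abs_lt.2 hy
    have hu := one_sub_two_mul_add_sq_pos hy' hx
    have hu' : HasDerivAt (fun y : ℝ => 1 + y ^ 2 - 2 * y * x) (2 * y - 2 * x) y := by
      have := ((hasDerivAt_pow 2 y).const_add 1).fun_sub
        (((hasDerivAt_id y).const_mul 2).mul_const x)
      simpa using this
    refine ((hasDerivAt_tsum_legendre hy' hx).fun_mul (hu'.sqrt hu.ne')).congr_deriv ?_
    have hode := generating_function_ode hy' hx
    have hs := Real.sq_sqrt hu.le
    have hs0 := (Real.sqrt_pos.2 hu).ne'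
    generalize √(1 + y ^ 2 - 2 * y * x) = w at hs hs0 ⊢
    field_simp
    rw [hs]
    linear_combination hode
  have hconst := isOpen_Ioo.is_const_of_deriv_eq_zero isPreconnected_Ioo
    (fun y hy => (hder y hy).differentiableAt.differentiableWithinAt)
    (fun y hy => (hder y hy).deriv) (abs_lt.1 hg)
    (⟨by norm_num, by norm_num⟩ : (0 : ℝ) ∈ Set.Ioo (-1 : ℝ) 1)
  have h0 : S 0 = 1 := by
    rw [hSdef]
    simp only
    rw [tsum_eq_single 0 fun n hn => by simp [hn]]
    simp [legendre]
  have hu := Real.sqrt_pos.2 (one_sub_two_mul_add_sq_pos hg hx)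
  have hval : S g = 1 / √(1 + g ^ 2 - 2 * g * x) := by
    rw [eq_div_iff hu.ne', hconst, h0]
    simp
  rw [← hval]
  exact (summable_pow_mul_legendre hg hx).hasSum

lemma mem_Icc_spherical (θ μ φ : ℝ) :
    cos θ * cos μ + sin θ * sin μ * cos φ ∈ Set.Icc (-1) 1 := by
  have hp := mul_nonneg (sub_nonneg.2 (cos_le_one φ)) (sub_nonneg.2 (cos_le_one (θ + μ)))
  have hp' := mul_nonneg (sub_nonneg.2 (cos_le_one φ))
    (neg_le_iff_add_nonneg.1 (neg_one_le_cos (θ + μ)))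
  have hm := mul_nonneg (neg_le_iff_add_nonneg.1 (neg_one_le_cos φ))
    (sub_nonneg.2 (cos_le_one (θ - μ)))
  have hm' := mul_nonneg (neg_le_iff_add_nonneg.1 (neg_one_le_cos φ))
    (neg_le_iff_add_nonneg.1 (neg_one_le_cos (θ - μ)))
  rw [cos_add] at hp hp'
  rw [cos_sub] at hm hm'
  constructor <;> linarith

lemma continuous_legendre (n : ℕ) : Continuous (legendre n) := by
  rw [show legendre n = fun x => (poly n).eval x from funext fun x => (eval_poly n x).symm]
  exact (poly n).continuous

/-- The bilinear generating function of the Legendre polynomials as an integral. -/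
lemma hasSum_legendre_mul_legendre {g : ℝ} (hg : |g| < 1) (θ μ : ℝ) :
    HasSum (fun n : ℕ => π * (g ^ n * legendre n (cos θ) * legendre n (cos μ)))
      (∫ φ in (0 : ℝ)..π,
        1 / √(1 + g ^ 2 - 2 * g * (cos θ * cos μ + sin θ * sin μ * cos φ))) := by
  have h := intervalIntegral.hasSum_integral_of_dominated_convergence
    (μ := MeasureTheory.volume) (a := 0) (b := π)
    (F := fun n φ => g ^ n * legendre n (cos θ * cos μ + sin θ * sin μ * cos φ))
    (f := fun φ => 1 / √(1 + g ^ 2 - 2 * g * (cos θ * cos μ + sin θ * sin μ * cos φ)))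
    (fun n _ => |g| ^ n)
    (fun n => by
      have := continuous_legendre n
      exact (by fun_prop : Continuous _).aestronglyMeasurable)
    (fun n => Filter.Eventually.of_forall fun φ _ => by
      rw [norm_mul, norm_pow, Real.norm_eq_abs, Real.norm_eq_abs]
      exact mul_le_of_le_one_right (by positivity)
        (abs_legendre_le_one n (mem_Icc_spherical θ μ φ)))
    (Filter.Eventually.of_forall fun φ _ =>
      summable_geometric_of_lt_one (abs_nonneg g) hg)
    intervalIntegrable_const
    (Filter.Eventually.of_forall fun φ _ => hasSum_legendre hg (mem_Icc_spherical θ μ φ))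
  refine h.congr_fun fun n => ?_
  rw [intervalIntegral.integral_const_mul, integral_legendre]
  ring

end Legendre

theorem H0_closed_form (g θ μ : ℝ) (hg : |g| < 1)
    (hθ : θ ∈ Set.Icc 0 π) (hμ : μ ∈ Set.Icc 0 π)
    (huminus : 0 < 1 + g^2 - 2*g*Real.cos (θ - μ)) :
    ∑' n : ℕ, g ^ n * legendre n (Real.cos θ) * legendre n (Real.cos μ)
      = (2 / (π * Real.sqrt (1 + g^2 - 2*g*Real.cos (θ + μ))))
          * K0 (((1 + g^2 - 2*g*Real.cos (θ + μ)) - (1 + g^2 - 2*g*Real.cos (θ - μ)))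
              / (1 + g^2 - 2*g*Real.cos (θ + μ))) := by
  have hsum := (Legendre.hasSum_legendre_mul_legendre hg θ μ).tsum_eq
  rw [tsum_mul_left] at hsum
  have hu : 0 < 1 + g ^ 2 - 2 * g * cos (θ + μ) :=
    Legendre.one_sub_two_mul_add_sq_pos hg (cos_mem_Icc _)
  have hsub := intervalIntegral.integral_comp_sub_mul (a := 0) (b := π / 2)
    (fun φ => 1 / √(1 + g ^ 2 - 2 * g * (cos θ * cos μ + sin θ * sin μ * cos φ)))
    (two_ne_zero) π
  rw [mul_div_cancel₀ π two_ne_zero, sub_self, mul_zero, sub_zero] at hsub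
  have hK : ∀ s : ℝ,
      1 / √(1 + g ^ 2 - 2 * g * (cos θ * cos μ + sin θ * sin μ * cos (π - 2 * s))) =
      (√(1 + g ^ 2 - 2 * g * cos (θ + μ)))⁻¹ *
        (1 / √(1 - ((1 + g ^ 2 - 2 * g * cos (θ + μ)) - (1 + g ^ 2 - 2 * g * cos (θ - μ)))
          / (1 + g ^ 2 - 2 * g * cos (θ + μ)) * sin s ^ 2)) := by
    intro s
    rw [one_div, one_div, ← mul_inv, ← Real.sqrt_mul hu.le]
    congr 2
    rw [mul_sub, mul_one, ← mul_assoc, mul_div_cancel₀ _ hu.ne', cos_pi_sub, cos_two_mul,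
      cos_sq', cos_add, cos_sub]
    ring
  simp only [hK] at hsub
  rw [intervalIntegral.integral_const_mul, ← hsum, smul_eq_mul] at hsub
  rw [K0]
  have hs := (Real.sqrt_pos.2 hu).ne'
  have hpi := pi_ne_zero
  rw [div_mul_eq_mul_div, eq_div_iff (by positivity)]
  rw [inv_mul_eq_iff_eq_mul₀ hs] at hsub
  rw [hsub]
  ring
end
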